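/- arXiv:quant-ph/0510106 — 2 statements merged into one kernel-verified Lean document; each statement's English description precedes it below -/
import Mathlib

section
/- Let n ≥ 2 be an integer and let A ∈ ℂ^{n²×n²} be invertible. Suppose that for each p ∈ {1,2,3,4} there exist a nonzero complex scalar α_p and integers a_{1p}, a_{2p}, a_{3p}, a_{4p} such that A⁻¹ A_p A = α_p · A₁^{a_{1p}} A₂^{a_{2p}} A₃^{a_{3p}} A₄^{a_{4p}}. Then the matrix X ∈ (ℤ/nℤ)^{4×4} with entries X_{ip} = a_{ip} mod n satisfies Xᵀ J X = J, i.e. X belongs to Sp(4, ℤ/nℤ). -/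
open Matrix Kronecker

noncomputable section

def ω (n : ℕ) : ℂ := Complex.exp (2 * Real.pi * Complex.I / n)

def Pmat (n : ℕ) : Matrix (Fin n) (Fin n) ℂ := Matrix.diagonal fun i => ω n ^ (i : ℕ)

def Qmat (n : ℕ) : Matrix (Fin n) (Fin n) ℂ :=
  Matrix.of fun i j => if (j : ℕ) = ((i : ℕ) + 1) % n then 1 else 0

def Amat (n : ℕ) : Fin 4 → Matrix (Fin n × Fin n) (Fin n × Fin n) ℂ :=
  ![Pmat n ⊗ₖ 1, Qmat n ⊗ₖ 1, (1 : Matrix (Fin n) (Fin n) ℂ) ⊗ₖ Pmat n,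
    (1 : Matrix (Fin n) (Fin n) ℂ) ⊗ₖ Qmat n]

def J4 (n : ℕ) : Matrix (Fin 4) (Fin 4) (ZMod n) := !![0,1,0,0; -1,0,0,0; 0,0,0,1; 0,0,-1,0]

/-- `x` and `y` commute up to the `k`-th power of `c`. -/
def CommuteUpTo {G : Type*} [Group G] (c : G) (k : ℤ) (x y : G) : Prop :=
  x * y = c ^ k * (y * x)

namespace CommuteUpTo

variable {G : Type*} [Group G] {c : G} {k l : ℤ} {x x' y : G}

lemma mul_left (hc : ∀ g : G, Commute c g) (hx : CommuteUpTo c k x y)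
    (hx' : CommuteUpTo c l x' y) : CommuteUpTo c (k + l) (x * x') y := by
  unfold CommuteUpTo at *
  have hcx : x * c ^ l = c ^ l * x := ((hc x).zpow_left l).eq.symm
  calc x * x' * y = x * (x' * y) := mul_assoc _ _ _
    _ = x * c ^ l * y * x' := by rw [hx']; simp only [mul_assoc]
    _ = c ^ l * (x * y) * x' := by rw [hcx]; simp only [mul_assoc]
    _ = c ^ l * c ^ k * (y * (x * x')) := by rw [hx]; simp only [mul_assoc]
    _ = c ^ (k + l) * (y * (x * x')) := by rw [← _root_.zpow_add, add_comm]

lemma symm (hx : CommuteUpTo c k x y) : CommuteUpTo c (-k) y x := by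
  unfold CommuteUpTo at *
  rw [hx, _root_.zpow_neg, inv_mul_cancel_left]

lemma one_left : CommuteUpTo c 0 1 y := by
  simp [CommuteUpTo]

lemma inv_left (hc : ∀ g : G, Commute c g) (hx : CommuteUpTo c k x y) :
    CommuteUpTo c (-k) x⁻¹ y := by
  unfold CommuteUpTo at *
  have hcx : x * c ^ (-k) = c ^ (-k) * x := ((hc x).zpow_left _).eq.symm
  rw [inv_mul_eq_iff_eq_mul, ← mul_assoc, hcx, mul_assoc, ← mul_assoc x y, hx]
  simp [mul_assoc]

lemma zpow_left (hc : ∀ g : G, Commute c g) (hx : CommuteUpTo c k x y) (m : ℤ) :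
    CommuteUpTo c (m * k) (x ^ m) y := by
  induction m with
  | zero => simpa using one_left
  | succ i ih =>
    rw [_root_.zpow_add_one, add_mul, one_mul]
    exact ih.mul_left hc hx
  | pred i ih =>
    rw [_root_.zpow_sub_one, sub_mul, one_mul, sub_eq_add_neg]
    exact ih.mul_left hc (hx.inv_left hc)

lemma monomial_left (hc : ∀ g : G, Commute c g) {u : Fin 4 → G} {b : Fin 4 → ℤ}
    (hu : ∀ i, CommuteUpTo c (b i) (u i) y) (m : Fin 4 → ℤ) :
    CommuteUpTo c (∑ i, m i * b i) (u 0 ^ m 0 * u 1 ^ m 1 * u 2 ^ m 2 * u 3 ^ m 3) y := by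
  rw [Fin.sum_univ_four]
  exact ((((hu 0).zpow_left hc _).mul_left hc ((hu 1).zpow_left hc _)).mul_left hc
    ((hu 2).zpow_left hc _)).mul_left hc ((hu 3).zpow_left hc _)

lemma monomial (hc : ∀ g : G, Commute c g) {u : Fin 4 → G} {B : Fin 4 → Fin 4 → ℤ}
    (hu : ∀ i j, CommuteUpTo c (B i j) (u i) (u j)) (m m' : Fin 4 → ℤ) :
    CommuteUpTo c (∑ i, ∑ j, m i * B i j * m' j)
      (u 0 ^ m 0 * u 1 ^ m 1 * u 2 ^ m 2 * u 3 ^ m 3)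
      (u 0 ^ m' 0 * u 1 ^ m' 1 * u 2 ^ m' 2 * u 3 ^ m' 3) := by
  convert monomial_left hc (fun i => (monomial_left hc (fun j => (hu i j).symm) m').symm) m using 1
  refine Finset.sum_congr rfl fun i _ => ?_
  rw [← Finset.sum_neg_distrib, Finset.mul_sum]
  exact Finset.sum_congr rfl fun j _ => by ring

lemma conj (hc : ∀ g : G, Commute c g) (hx : CommuteUpTo c k x y) (g : G) :
    CommuteUpTo c k (g⁻¹ * x * g) (g⁻¹ * y * g) := by
  unfold CommuteUpTo at *
  have hcg : g⁻¹ * c ^ k = c ^ k * g⁻¹ := ((hc g⁻¹).zpow_left k).eq.symm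
  calc g⁻¹ * x * g * (g⁻¹ * y * g) = g⁻¹ * (x * y) * g := by group
    _ = g⁻¹ * c ^ k * (y * x) * g := by rw [hx]; simp only [mul_assoc]
    _ = c ^ k * (g⁻¹ * y * g * (g⁻¹ * x * g)) := by rw [hcg]; group

lemma of_central_mul {s t : G} (hs : ∀ g : G, Commute s g) (ht : ∀ g : G, Commute t g)
    (hx : CommuteUpTo c k (s * x) (t * y)) : CommuteUpTo c k x y := by
  unfold CommuteUpTo at *
  have h₁ : s * x * (t * y) = s * t * (x * y) := by
    rw [mul_assoc, ← mul_assoc x, ← (ht x).eq]; simp only [mul_assoc]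
  have h₂ : c ^ k * (t * y * (s * x)) = s * t * (c ^ k * (y * x)) := by
    have h₃ : t * y * (s * x) = s * t * (y * x) := by
      rw [mul_assoc t, ← mul_assoc y, ← (hs y).eq, (hs t).eq]; simp only [mul_assoc]
    rw [h₃, ← mul_assoc, ← ((hs (c ^ k)).mul_left (ht (c ^ k))).eq, mul_assoc]
  rw [h₁, h₂] at hx
  exact mul_left_cancel hx

lemma zpow_eq (hx : CommuteUpTo c k x y) (hx' : CommuteUpTo c l x y) : c ^ k = c ^ l := by
  unfold CommuteUpTo at *
  exact mul_right_cancel (hx.symm.trans hx')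

end CommuteUpTo

/-- The integral form of `J4`. -/
def J4Int : Matrix (Fin 4) (Fin 4) ℤ := !![0,1,0,0; -1,0,0,0; 0,0,0,1; 0,0,-1,0]

lemma J4_eq_map (n : ℕ) : J4 n = J4Int.map (Int.cast : ℤ → ZMod n) := by
  ext i j
  fin_cases i <;> fin_cases j <;> simp [J4, J4Int]

lemma ω_ne_zero (n : ℕ) : ω n ≠ 0 := Complex.exp_ne_zero _

lemma isPrimitiveRoot_ω {n : ℕ} (hn : n ≠ 0) : IsPrimitiveRoot (ω n) n :=
  Complex.isPrimitiveRoot_exp n hn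

lemma Qmat_apply {n : ℕ} [NeZero n] (i j : Fin n) : Qmat n i j = if j = i + 1 then 1 else 0 := by
  simp [Qmat, Fin.ext_iff, Fin.val_add]

lemma isUnit_Pmat (n : ℕ) : IsUnit (Pmat n) := by
  rw [Pmat, Matrix.isUnit_diagonal, Pi.isUnit_iff]
  exact fun i => (pow_ne_zero _ (ω_ne_zero n)).isUnit

lemma isUnit_Qmat (n : ℕ) [NeZero n] : IsUnit (Qmat n) := by
  refine IsUnit.of_mul_eq_one (Qmat n)ᵀ ?_
  ext i j
  simp [Matrix.mul_apply, Qmat_apply, Matrix.one_apply, eq_comm]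

lemma Qmat_mul_Pmat (n : ℕ) [NeZero n] : Qmat n * Pmat n = ω n • (Pmat n * Qmat n) := by
  ext i j
  rw [Pmat, Matrix.mul_diagonal, Matrix.smul_apply, Matrix.diagonal_mul, Qmat_apply]
  split_ifs with hij
  · subst hij
    have hval : ω n ^ ((i + 1 : Fin n) : ℕ) = ω n ^ ((i : ℕ) + 1) := by
      rw [Fin.val_add, pow_eq_pow_mod ((i : ℕ) + 1) (isPrimitiveRoot_ω (NeZero.ne n)).pow_eq_one]
      simp
    simp [hval, pow_succ']
  · simp

lemma isUnit_kronecker {l m R : Type*} [Fintype l] [DecidableEq l] [Fintype m] [DecidableEq m]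
    [CommRing R] {M : Matrix l l R} {N : Matrix m m R} (hM : IsUnit M) (hN : IsUnit N) :
    IsUnit (M ⊗ₖ N) := by
  rw [Matrix.isUnit_iff_isUnit_det] at *
  rw [Matrix.det_kronecker]
  exact (hM.pow _).mul (hN.pow _)

lemma isUnit_Amat (n : ℕ) [NeZero n] (p : Fin 4) : IsUnit (Amat n p) := by
  fin_cases p
  · exact isUnit_kronecker (isUnit_Pmat n) isUnit_one
  · exact isUnit_kronecker (isUnit_Qmat n) isUnit_one
  · exact isUnit_kronecker isUnit_one (isUnit_Pmat n)
  · exact isUnit_kronecker isUnit_one (isUnit_Qmat n)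

lemma Amat_mul_Amat (n : ℕ) [NeZero n] (p q : Fin 4) :
    Amat n p * Amat n q = ω n ^ (-J4Int p q) • (Amat n q * Amat n p) := by
  have hω := ω_ne_zero n
  have hPQ : Pmat n * Qmat n = (ω n)⁻¹ • (Qmat n * Pmat n) := by
    rw [Qmat_mul_Pmat, smul_smul, inv_mul_cancel₀ hω, one_smul]
  fin_cases p <;> fin_cases q <;>
    simp [Amat, J4Int, ← Matrix.mul_kronecker_mul, hPQ, smul_smul, hω,
      Matrix.smul_kronecker, Matrix.kronecker_smul]

/-- The scalar matrices as central units. -/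
def scalarUnit (m : Type*) [Fintype m] [DecidableEq m] : ℂˣ →* (Matrix m m ℂ)ˣ :=
  Units.map (algebraMap ℂ (Matrix m m ℂ)).toMonoidHom

section scalarUnit

variable {m : Type*} [Fintype m] [DecidableEq m]

lemma coe_scalarUnit_mul (z : ℂˣ) (x : (Matrix m m ℂ)ˣ) :
    ((scalarUnit m z * x : (Matrix m m ℂ)ˣ) : Matrix m m ℂ) = (z : ℂ) • (x : Matrix m m ℂ) := by
  simp [scalarUnit, Algebra.smul_def]

lemma scalarUnit_commute (z : ℂˣ) (x : (Matrix m m ℂ)ˣ) : Commute (scalarUnit m z) x :=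
  Units.ext (Algebra.commutes (z : ℂ) (x : Matrix m m ℂ))

lemma scalarUnit_injective [Nonempty m] : Function.Injective (scalarUnit m) :=
  Units.map_injective (algebraMap ℂ (Matrix m m ℂ)).injective

end scalarUnit

/-- If conjugation by an invertible `A ∈ ℂ^{n²×n²}` sends each `A_p` to a
nonzero scalar multiple of `A₁^{a₁ₚ}A₂^{a₂ₚ}A₃^{a₃ₚ}A₄^{a₄ₚ}` (integer exponents), then the
matrix of exponents mod `n` lies in `Sp(4, ℤ/nℤ)`. -/
theorem statement2 (n : ℕ) (hn : 2 ≤ n)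
    (A : Matrix (Fin n × Fin n) (Fin n × Fin n) ℂ) (hA : IsUnit A.det)
    (a : Fin 4 → Fin 4 → ℤ) (α : Fin 4 → ℂ) (hα : ∀ p, α p ≠ 0)
    (h : ∀ p : Fin 4, A⁻¹ * Amat n p * A =
      α p • (Amat n 0 ^ a 0 p * Amat n 1 ^ a 1 p * Amat n 2 ^ a 2 p * Amat n 3 ^ a 3 p)) :
    (Matrix.of fun i p : Fin 4 => ((a i p : ZMod n)))ᵀ * J4 n *
      (Matrix.of fun i p : Fin 4 => ((a i p : ZMod n))) = J4 n := by
  have : NeZero n := ⟨by omega⟩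
  let c : (Matrix (Fin n × Fin n) (Fin n × Fin n) ℂ)ˣ :=
    scalarUnit _ (Units.mk0 (ω n) (ω_ne_zero n))
  have hc : ∀ g, Commute c g := scalarUnit_commute _
  let u : Fin 4 → (Matrix (Fin n × Fin n) (Fin n × Fin n) ℂ)ˣ := fun p => (isUnit_Amat n p).unit
  let g : (Matrix (Fin n × Fin n) (Fin n × Fin n) ℂ)ˣ := A.nonsingInvUnit hA
  have hg : (g : Matrix (Fin n × Fin n) (Fin n × Fin n) ℂ) = A := rfl
  let s : Fin 4 → (Matrix (Fin n × Fin n) (Fin n × Fin n) ℂ)ˣ :=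
    fun p => scalarUnit _ (Units.mk0 (α p) (hα p))
  have hs : ∀ p g, Commute (s p) g := fun p => scalarUnit_commute _
  have hu : ∀ p q, CommuteUpTo c (-J4Int p q) (u p) (u q) := fun p q => Units.ext <| by
    rw [← map_zpow, coe_scalarUnit_mul]
    simpa [u] using Amat_mul_Amat n p q
  have hconj : ∀ p, g⁻¹ * u p * g =
      s p * (u 0 ^ a 0 p * u 1 ^ a 1 p * u 2 ^ a 2 p * u 3 ^ a 3 p) := fun p => Units.ext <| by
    rw [coe_scalarUnit_mul]
    simpa [u, hg, Matrix.coe_units_zpow, Matrix.coe_units_inv] using h p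
  rw [J4_eq_map]
  ext p q
  have h₁ := (hu p q).conj hc g
  rw [hconj, hconj] at h₁
  have h₂ := CommuteUpTo.monomial hc hu (fun i => a i p) (fun i => a i q)
  have h₃ := (CommuteUpTo.of_central_mul (hs p) (hs q) h₁).zpow_eq h₂
  rw [← map_zpow, ← map_zpow] at h₃
  have h₄ : ω n ^ (-J4Int p q) = ω n ^ (∑ i, ∑ j, a i p * -J4Int i j * a j q) := by
    simpa using congrArg Units.val (scalarUnit_injective h₃)
  have h₅ : (n : ℤ) ∣ -J4Int p q - ∑ i, ∑ j, a i p * -J4Int i j * a j q := by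
    rw [← (isPrimitiveRoot_ω (NeZero.ne n)).zpow_eq_one_iff_dvd, zpow_sub₀ (ω_ne_zero n), h₄,
      div_self (zpow_ne_zero _ (ω_ne_zero n))]
  have h₆ := (ZMod.intCast_zmod_eq_zero_iff_dvd _ n).2 h₅
  push_cast at h₆
  simp only [Matrix.mul_apply, Matrix.transpose_apply, Matrix.of_apply, Matrix.map_apply,
    Finset.sum_mul]
  rw [Finset.sum_comm]
  simp only [mul_neg, neg_mul, Finset.sum_neg_distrib, sub_neg_eq_add] at h₆
  linear_combination h₆
end
end

section
/- Let n ≥ 2 be an integer. The map Out_I : sl(n²,ℂ) → sl(n²,ℂ), X ↦ −Xᵀ, is a Lie algebra automorphism that belongs to the normalizer N(G), and it satisfies Out_I ∘ Ad_{A₁} ∘ Out_I⁻¹ = Ad_{A₁⁻¹}, Out_I ∘ Ad_{A₂} ∘ Out_I⁻¹ = Ad_{A₂}, Out_I ∘ Ad_{A₃} ∘ Out_I⁻¹ = Ad_{A₃⁻¹}, and Out_I ∘ Ad_{A₄} ∘ Out_I⁻¹ = Ad_{A₄}. -/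
open Matrix Kronecker

noncomputable section

abbrev slp (n : ℕ) := LieAlgebra.SpecialLinear.sl (Fin n × Fin n) ℂ

abbrev Aut (n : ℕ) := ↥(slp n) ≃ₗ⁅ℂ⁆ ↥(slp n)

instance (n : ℕ) : Group (Aut n) where
  mul f g := g.trans f
  one := LieEquiv.refl
  inv := LieEquiv.symm
  mul_assoc f g h := LieEquiv.ext fun x => rfl
  one_mul f := LieEquiv.ext fun x => rfl
  mul_one f := LieEquiv.ext fun x => rfl
  inv_mul_cancel f := LieEquiv.ext fun x => f.symm_apply_apply x

def actsAsAd {n : ℕ} (M : Matrix (Fin n × Fin n) (Fin n × Fin n) ℂ) (φ : Aut n) : Prop :=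
  ∀ X : slp n, (φ X : Matrix (Fin n × Fin n) (Fin n × Fin n) ℂ) = M⁻¹ * (X : Matrix (Fin n × Fin n) (Fin n × Fin n) ℂ) * M

def Gset (n : ℕ) : Set (Aut n) :=
  {φ | ∃ i j k l : ℕ, actsAsAd ((Pmat n ^ i * Qmat n ^ j) ⊗ₖ (Pmat n ^ k * Qmat n ^ l)) φ}

def Nset (n : ℕ) : Set (Aut n) := {g | ∀ h ∈ Gset n, g * h * g⁻¹ ∈ Gset n}

def IsInnerAut {n : ℕ} (φ : Aut n) : Prop :=
  ∃ M : Matrix (Fin n × Fin n) (Fin n × Fin n) ℂ, IsUnit M.det ∧ actsAsAd M φ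

def NinSet (n : ℕ) : Set (Aut n) := {φ | φ ∈ Nset n ∧ IsInnerAut φ}

/-- The outer automorphism `X ↦ -Xᵀ` of `sl(n²,ℂ)`. -/
def outI (n : ℕ) : Aut n where
  toFun X := ⟨-(X.1ᵀ), by
    have h : Matrix.trace X.1 = 0 := X.2
    change Matrix.trace (-(X.1ᵀ)) = 0
    simp [h]⟩
  invFun X := ⟨-(X.1ᵀ), by
    have h : Matrix.trace X.1 = 0 := X.2
    change Matrix.trace (-(X.1ᵀ)) = 0
    simp [h]⟩
  map_add' X Y := Subtype.ext (by simp [add_comm])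
  map_smul' c X := Subtype.ext (by simp)
  map_lie' {X Y} := Subtype.ext (by simp [Ring.lie_def])
  left_inv X := Subtype.ext (by simp)
  right_inv X := Subtype.ext (by simp)

lemma coe_outI {n : ℕ} (X : slp n) : (outI n X).1 = -(X.1ᵀ) := rfl

lemma coe_outI_conj {n : ℕ} (φ : Aut n) (X : slp n) :
    ((outI n * φ * (outI n)⁻¹) X).1 = -((φ (outI n X)).1ᵀ) := rfl

lemma actsAsAd_outI_conj {n : ℕ} {M N : Matrix (Fin n × Fin n) (Fin n × Fin n) ℂ}
    {φ : Aut n} (hφ : actsAsAd M φ) (h : Mᵀ * N = 1) :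
    actsAsAd N (outI n * φ * (outI n)⁻¹) := by
  intro X
  have hN : N⁻¹ = Mᵀ := Matrix.inv_eq_left_inv h
  have hM : M⁻¹ = Nᵀ := Matrix.inv_eq_left_inv (by simpa using congrArg Matrix.transpose h)
  rw [coe_outI_conj, hφ, coe_outI, hN, hM]
  simp [Matrix.mul_assoc]

lemma actsAsAd_unique {n : ℕ} {M : Matrix (Fin n × Fin n) (Fin n × Fin n) ℂ}
    {φ ψ : Aut n} (hφ : actsAsAd M φ) (hψ : actsAsAd M ψ) : φ = ψ :=
  LieEquiv.ext fun X => Subtype.ext ((hφ X).trans (hψ X).symm)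

lemma omega_pow_self {n : ℕ} (hn : n ≠ 0) : ω n ^ n = 1 :=
  (Complex.isPrimitiveRoot_exp n hn).pow_eq_one

lemma Pmat_transpose (n : ℕ) : (Pmat n)ᵀ = Pmat n := Matrix.diagonal_transpose _

lemma Pmat_pow_self {n : ℕ} (hn : n ≠ 0) : Pmat n ^ n = 1 := by
  rw [Pmat, Matrix.diagonal_pow, ← Matrix.diagonal_one]
  congr 1
  funext i
  simp [← pow_mul, mul_comm (i : ℕ) n, pow_mul (ω n) n, omega_pow_self hn]

lemma Pmat_mul_pow {n : ℕ} (hn : n ≠ 0) : Pmat n * Pmat n ^ (n - 1) = 1 := by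
  rw [mul_pow_sub_one hn, Pmat_pow_self hn]

lemma Qmat_mul_transpose (n : ℕ) : Qmat n * (Qmat n)ᵀ = 1 := by
  ext i j
  have hpos : 0 < n := i.pos
  rw [Matrix.mul_apply, Finset.sum_eq_single (⟨((i : ℕ) + 1) % n, Nat.mod_lt _ hpos⟩ : Fin n)]
  · have key : ((i : ℕ) + 1) % n = ((j : ℕ) + 1) % n ↔ i = j := by
      refine ⟨fun h => Fin.ext ?_, fun h => by rw [h]⟩
      have h' : (i : ℕ) ≡ j [MOD n] := Nat.ModEq.add_right_cancel' 1 h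
      exact h'.eq_of_lt_of_lt i.2 j.2
    simp [Qmat, key, Matrix.one_apply]
  · intro k _ hk
    have : (k : ℕ) ≠ ((i : ℕ) + 1) % n := fun h => hk (Fin.ext h)
    simp [Qmat, this]
  · simp

lemma Qmat_transpose_mul (n : ℕ) : (Qmat n)ᵀ * Qmat n = 1 :=
  mul_eq_one_comm.mp (Qmat_mul_transpose n)

lemma transpose_Pmat_pow_mul_Qmat_pow {n : ℕ} (hn : n ≠ 0) (i j : ℕ) :
    (Pmat n ^ i * Qmat n ^ j)ᵀ * (Pmat n ^ ((n - 1) * i) * Qmat n ^ j) = 1 := by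
  have hP : Pmat n ^ i * Pmat n ^ ((n - 1) * i) = 1 := by
    rw [pow_mul]
    exact pow_mul_pow_eq_one i (Pmat_mul_pow hn)
  rw [Matrix.transpose_mul, Matrix.transpose_pow, Matrix.transpose_pow, Pmat_transpose,
    Matrix.mul_assoc, ← Matrix.mul_assoc (Pmat n ^ i), hP, Matrix.one_mul]
  exact pow_mul_pow_eq_one j (Qmat_transpose_mul n)

lemma transpose_kronecker_mul_eq_one {m : Type*} [Fintype m] [DecidableEq m]
    {A B C D : Matrix m m ℂ} (h₁ : Aᵀ * C = 1) (h₂ : Bᵀ * D = 1) :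
    (A ⊗ₖ B)ᵀ * (C ⊗ₖ D) = 1 := by
  rw [← Matrix.kroneckerMap_transpose, ← Matrix.mul_kronecker_mul, h₁, h₂, Matrix.one_kronecker_one]

lemma outI_mem_Nset {n : ℕ} (hn : n ≠ 0) : outI n ∈ Nset n := by
  rintro φ ⟨i, j, k, l, hφ⟩
  exact ⟨(n - 1) * i, j, (n - 1) * k, l, actsAsAd_outI_conj hφ
    (transpose_kronecker_mul_eq_one (transpose_Pmat_pow_mul_Qmat_pow hn i j)
      (transpose_Pmat_pow_mul_Qmat_pow hn k l))⟩

lemma actsAsAd_inv_outI_conj {n : ℕ} {M N : Matrix (Fin n × Fin n) (Fin n × Fin n) ℂ}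
    {φ : Aut n} (hφ : actsAsAd M φ) (hM : Mᵀ = M) (h : Mᵀ * N = 1) :
    actsAsAd M⁻¹ (outI n * φ * (outI n)⁻¹) := by
  rw [Matrix.inv_eq_right_inv (hM ▸ h)]
  exact actsAsAd_outI_conj hφ h

/-- The map `Out_I : X ↦ −Xᵀ` is a Lie algebra automorphism of
`sl(n²,ℂ)` belonging to the normalizer `N(G)`, and conjugation by it sends
`Ad_{A₁} ↦ Ad_{A₁⁻¹}`, `Ad_{A₂} ↦ Ad_{A₂}`, `Ad_{A₃} ↦ Ad_{A₃⁻¹}`, `Ad_{A₄} ↦ Ad_{A₄}`.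
(Here `a j` denotes the inner automorphism `Ad_{A_j}`, characterized by its action, and
an automorphism equals `Ad_{A_j⁻¹}` iff it acts as `X ↦ (A_j⁻¹)⁻¹ X A_j⁻¹`.) -/
theorem statement5 (n : ℕ) (hn : 2 ≤ n) :
    ∃ Φ : Aut n,
      (∀ X : slp n, (Φ X : Matrix (Fin n × Fin n) (Fin n × Fin n) ℂ) =
        -((X : Matrix (Fin n × Fin n) (Fin n × Fin n) ℂ)ᵀ)) ∧
      Φ ∈ Nset n ∧
      ∀ a : Fin 4 → Aut n, (∀ j, actsAsAd (Amat n j) (a j)) →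
        actsAsAd (Amat n 0)⁻¹ (Φ * a 0 * Φ⁻¹) ∧
        Φ * a 1 * Φ⁻¹ = a 1 ∧
        actsAsAd (Amat n 2)⁻¹ (Φ * a 2 * Φ⁻¹) ∧
        Φ * a 3 * Φ⁻¹ = a 3 := by
  have hn0 : n ≠ 0 := by omega
  have hP : (Pmat n)ᵀ * Pmat n ^ (n - 1) = 1 := by rw [Pmat_transpose, Pmat_mul_pow hn0]
  have h1 : (1 : Matrix (Fin n) (Fin n) ℂ)ᵀ * 1 = 1 := by simp
  refine ⟨outI n, coe_outI, outI_mem_Nset hn0, fun a ha => ⟨?_, ?_, ?_, ?_⟩⟩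
  · exact actsAsAd_inv_outI_conj (ha 0)
      (by simp [Amat, ← Matrix.kroneckerMap_transpose, Pmat_transpose])
      (transpose_kronecker_mul_eq_one hP h1)
  · exact actsAsAd_unique (actsAsAd_outI_conj (ha 1)
      (transpose_kronecker_mul_eq_one (Qmat_transpose_mul n) h1)) (ha 1)
  · exact actsAsAd_inv_outI_conj (ha 2)
      (by simp [Amat, ← Matrix.kroneckerMap_transpose, Pmat_transpose])
      (transpose_kronecker_mul_eq_one h1 hP)
  · exact actsAsAd_unique (actsAsAd_outI_conj (ha 3)
      (transpose_kronecker_mul_eq_one h1 (Qmat_transpose_mul n))) (ha 3)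
end
end
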